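/- Fix an integer L ≥ 1 and real numbers q, J and α with 0 < α < 1. For the partially asymmetric, translationally invariant 1D pair Hamiltonian on the circle, H(σ,τ) = −∑_{i∈ℤ/Lℤ} ( α J σ_i τ_{i+1} + (1−α) J τ_i σ_{i+1} + q σ_i τ_i ), the weak balance condition holds: for every σ ∈ {−1,+1}^{ℤ/Lℤ}, ∑_{τ∈{−1,+1}^{ℤ/Lℤ}} exp(−H(σ,τ)) = ∑_{τ∈{−1,+1}^{ℤ/Lℤ}} exp(−H(τ,σ)). -/

import Mathlib

open Finset

theorem coe_spin_eq_or (s : ({-1, 1} : Finset ℝ)) : (s : ℝ) = -1 ∨ (s : ℝ) = 1 := by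
  obtain ⟨x, hx⟩ := s
  simpa using hx

/-- The partition function of independent spins in an external field `h`. -/
theorem sum_spin_exp_sum {ι : Type*} [Fintype ι] [DecidableEq ι] (h : ι → ℝ) :
    ∑ τ : ι → ({-1, 1} : Finset ℝ), Real.exp (∑ i, (τ i : ℝ) * h i) =
      ∏ i, (2 * Real.cosh (h i)) := by
  have key : ∀ x : ℝ, 2 * Real.cosh x = ∑ s : ({-1, 1} : Finset ℝ), Real.exp ((s : ℝ) * x) := by
    intro x
    rw [Finset.sum_coe_sort ({-1, 1} : Finset ℝ) (fun s => Real.exp (s * x)),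
      Finset.sum_pair (by norm_num), Real.cosh_eq]
    simp only [neg_mul, one_mul]
    ring
  simp_rw [key, Finset.prod_univ_sum, Fintype.piFinset_univ, Real.exp_sum]

/-- Exchanging the two neighbours of a spin changes the local weight by a coboundary factor. -/
theorem exists_cosh_swap_neighbors (a b q : ℝ) :
    ∃ c : ℝ, ∀ r s t : ({-1, 1} : Finset ℝ),
      Real.cosh (a * r + b * t + q * s) =
        Real.cosh (a * t + b * r + q * s) * Real.exp (c * ((r : ℝ) * s - s * t)) := by
  set A := a - b + q with hA
  set B := b - a + q with hB
  refine ⟨(Real.log (Real.cosh A) - Real.log (Real.cosh B)) / 2, fun r s t => ?_⟩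
  have swap : ∀ x y z : ℝ, (x = A ∨ x = -A) → (y = B ∨ y = -B) → z = 2 →
      Real.cosh x = Real.cosh y *
        Real.exp ((Real.log (Real.cosh A) - Real.log (Real.cosh B)) / 2 * z) := by
    rintro x y _ hx hy rfl
    rw [show Real.cosh x = Real.cosh A by rcases hx with rfl | rfl <;> simp,
      show Real.cosh y = Real.cosh B by rcases hy with rfl | rfl <;> simp,
      div_mul_cancel₀ _ two_ne_zero, Real.exp_sub, Real.exp_log (Real.cosh_pos A),
      Real.exp_log (Real.cosh_pos B), mul_div_cancel₀ _ (Real.cosh_pos B).ne']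
  have swap' : ∀ x y z : ℝ, (x = B ∨ x = -B) → (y = A ∨ y = -A) → z = -2 →
      Real.cosh x = Real.cosh y *
        Real.exp ((Real.log (Real.cosh A) - Real.log (Real.cosh B)) / 2 * z) := by
    rintro x y _ hx hy rfl
    rw [swap y x 2 hy hx rfl, mul_assoc, ← Real.exp_add]
    simp
  rcases coe_spin_eq_or r with hr | hr <;> rcases coe_spin_eq_or t with ht | ht <;>
    rcases coe_spin_eq_or s with hs | hs <;> rw [hr, hs, ht]
  · simp
  · simp
  · exact swap _ _ _ (.inr (by rw [hA]; ring)) (.inr (by rw [hB]; ring)) (by norm_num)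
  · exact swap' _ _ _ (.inl (by rw [hB]; ring)) (.inl (by rw [hA]; ring)) (by norm_num)
  · exact swap' _ _ _ (.inr (by rw [hB]; ring)) (.inr (by rw [hA]; ring)) (by norm_num)
  · exact swap _ _ _ (.inl (by rw [hA]; ring)) (.inl (by rw [hB]; ring)) (by norm_num)
  · simp
  · simp

theorem prod_cosh_swap_neighbors (L : ℕ) [NeZero L] (a b q : ℝ)
    (σ : ZMod L → ({-1, 1} : Finset ℝ)) :
    ∏ i, (2 * Real.cosh (a * σ (i - 1) + b * σ (i + 1) + q * σ i)) =
      ∏ i, (2 * Real.cosh (a * σ (i + 1) + b * σ (i - 1) + q * σ i)) := by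
  obtain ⟨c, hc⟩ := exists_cosh_swap_neighbors a b q
  have hshift : ∑ i, (σ (i - 1) : ℝ) * σ i = ∑ i, (σ i : ℝ) * σ (i + 1) := by
    rw [← Equiv.sum_comp (Equiv.addRight (1 : ZMod L))]
    simp
  simp_rw [fun i => hc (σ (i - 1)) (σ i) (σ (i + 1)), ← mul_assoc]
  rw [Finset.prod_mul_distrib, ← Real.exp_sum, ← Finset.mul_sum, Finset.sum_sub_distrib, hshift]
  simp

/-- **Weak balance for the partially asymmetric, translationally invariant 1D Ising
PCA on the circle.** For `0 < α < 1` and Hamiltonian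
`H (σ,τ) = -∑ i, (α * J * σ i * τ (i+1) + (1 - α) * J * τ i * σ (i+1) + q * σ i * τ i)`
on spin configurations on `ℤ/Lℤ`, the weak balance condition
`∑ τ, exp (-H (σ,τ)) = ∑ τ, exp (-H (τ,σ))` holds for every `σ`. -/
theorem one_d_circle_partially_asymmetric_weak_balance
    (L : ℕ) [NeZero L] (q J α : ℝ) (hα0 : 0 < α) (hα1 : α < 1)
    (H : (ZMod L → ({-1, 1} : Finset ℝ)) → (ZMod L → ({-1, 1} : Finset ℝ)) → ℝ)
    (hH : ∀ σ τ, H σ τ =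
      -∑ i : ZMod L,
        (α * J * (σ i : ℝ) * (τ (i + 1) : ℝ) + (1 - α) * J * (τ i : ℝ) * (σ (i + 1) : ℝ)
          + q * (σ i : ℝ) * (τ i : ℝ))) :
    ∀ σ : ZMod L → ({-1, 1} : Finset ℝ),
      ∑ τ : ZMod L → ({-1, 1} : Finset ℝ), Real.exp (-H σ τ) =
        ∑ τ : ZMod L → ({-1, 1} : Finset ℝ), Real.exp (-H τ σ) := by
  intro σ
  have hout : ∀ τ, -H σ τ = ∑ i, (τ i : ℝ) *
      (α * J * σ (i - 1) + (1 - α) * J * σ (i + 1) + q * σ i) := by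
    intro τ
    have hshift : ∑ i, α * J * (σ i : ℝ) * τ (i + 1) = ∑ i, α * J * (σ (i - 1) : ℝ) * τ i := by
      rw [← Equiv.sum_comp (Equiv.addRight (1 : ZMod L))
        (fun i => α * J * (σ (i - 1) : ℝ) * τ i)]
      simp
    rw [hH, neg_neg, Finset.sum_add_distrib, Finset.sum_add_distrib, hshift,
      ← Finset.sum_add_distrib, ← Finset.sum_add_distrib]
    exact Finset.sum_congr rfl fun i _ => by ring
  have hin : ∀ τ, -H τ σ = ∑ i, (τ i : ℝ) *
      (α * J * σ (i + 1) + (1 - α) * J * σ (i - 1) + q * σ i) := by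
    intro τ
    have hshift : ∑ i, (1 - α) * J * (σ i : ℝ) * τ (i + 1) =
        ∑ i, (1 - α) * J * (σ (i - 1) : ℝ) * τ i := by
      rw [← Equiv.sum_comp (Equiv.addRight (1 : ZMod L))
        (fun i => (1 - α) * J * (σ (i - 1) : ℝ) * τ i)]
      simp
    rw [hH, neg_neg, Finset.sum_add_distrib, Finset.sum_add_distrib, hshift,
      ← Finset.sum_add_distrib, ← Finset.sum_add_distrib]
    exact Finset.sum_congr rfl fun i _ => by ring
  simp_rw [hout, hin]
  rw [sum_spin_exp_sum, sum_spin_exp_sum]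
  exact prod_cosh_swap_neighbors L (α * J) ((1 - α) * J) q σ
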